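/- arXiv:2604.25079 — 2 statements merged into one kernel-verified Lean document; each statement's English description precedes it below -/
import Mathlib

section
/- Let n ∈ ℕ, n−1 < α ≤ n, let I ⊆ ℝ be an open interval, f : I → (0,∞) smooth, β ∈ I, a₁, a₂ ∈ ℝ, and c_{k,1}, c_{k,2} ∈ ℝ for k = 1,…,n. Define for t > 0: φ_k(t) = E_{α,1+α−k}((a₁+a₂) t^α) and ψ_k(t) = E_{α,1+α−k}((a₂−a₁) t^α), and set u(x,t) = f(x)^{−1/2} [exp((a₁+a₂)ω_0(x)) Σ_{k=1}^n c_{k,1} t^{α−k} φ_k(t) + exp((a₁−a₂)ω_0(x)) Σ_{k=1}^n c_{k,2} t^{α−k} ψ_k(t)], v(x,t) = exp((a₁+a₂)ω_0(x)) Σ_{k=1}^n c_{k,1} t^{α−k} φ_k(t) − exp((a₁−a₂)ω_0(x)) Σ_{k=1}^n c_{k,2} t^{α−k} ψ_k(t). Then ∂^α_t u = ∂_x v and ∂^α_t v = f(x) ∂_x u + (f'(x)/2) u hold on I × (0,∞). -/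
open MeasureTheory Real Set

noncomputable section

/-- The Riemann–Liouville kernel: for `α = n` it is `h` itself; for `n - 1 < α < n`
it is the fractional integral of order `n - α` of `h`. -/
def rlKernel (n : ℕ) (α : ℝ) (h : ℝ → ℝ) : ℝ → ℝ :=
  if α = (n : ℝ) then h
  else fun t => (Real.Gamma ((n : ℝ) - α))⁻¹ *
    ∫ s in (0:ℝ)..t, h s * (t - s) ^ ((n : ℝ) - α - 1)

/-- The Riemann–Liouville fractional derivative of order `α` (with `n - 1 < α ≤ n`). -/
def rlDeriv (n : ℕ) (α : ℝ) (h : ℝ → ℝ) : ℝ → ℝ :=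
  iteratedDeriv n (rlKernel n α h)

/-- The Riemann–Liouville derivative of order `α` of `h` exists on `(0, ∞)`. -/
def HasRLDerivOn (n : ℕ) (α : ℝ) (h : ℝ → ℝ) : Prop :=
  ContDiffOn ℝ n (rlKernel n α h) (Set.Ioi 0)

/-- The two-parameter Mittag–Leffler function `E_{ρ,b}(z) = Σ_{j≥0} z^j / Γ(ρj + b)`,
with the convention that `1/Γ` vanishes at the poles of `Γ` (Mathlib's `Real.Gamma`
is `0` there). -/
def mittagLeffler (ρ b z : ℝ) : ℝ :=
  ∑' j : ℕ, z ^ j / Real.Gamma (ρ * j + b)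

lemma rpow_mul_exp_neg_le_Gamma {M x : ℝ} (hM : 0 < M) (hx : 1 ≤ x) :
    M ^ (x - 1) * Real.exp (-M) ≤ Real.Gamma x := by
  have hx0 : 0 < x := by linarith
  have hint := Real.GammaIntegral_convergent hx0
  have hsub : Ioi M ⊆ Ioi (0 : ℝ) := Ioi_subset_Ioi hM.le
  rw [Real.Gamma_eq_integral hx0, ← integral_exp_neg_Ioi, ← integral_const_mul]
  calc ∫ y in Ioi M, M ^ (x - 1) * Real.exp (-y)
      ≤ ∫ y in Ioi M, Real.exp (-y) * y ^ (x - 1) := by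
        refine setIntegral_mono_on ((integrableOn_exp_neg_Ioi M).const_mul _)
          (hint.mono_set hsub) measurableSet_Ioi fun y hy => ?_
        rw [mul_comm]
        gcongr
        exact le_of_lt hy
    _ ≤ ∫ y in Ioi 0, Real.exp (-y) * y ^ (x - 1) := by
        refine setIntegral_mono_set hint ?_ hsub.eventuallyLE
        filter_upwards [ae_restrict_mem measurableSet_Ioi] with y hy
        have : (0 : ℝ) < y := hy
        positivity

/-- The generalized power series `∑ⱼ lʲ t^(αj+p) / Γ(αj+p+1)`. -/
def mittagLefflerSeries (α l p t : ℝ) : ℝ :=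
  ∑' j : ℕ, l ^ j * t ^ (α * j + p) / Real.Gamma (α * j + p + 1)

lemma summable_mittagLefflerSeries {α : ℝ} (hα : 0 < α) (l p : ℝ) {t : ℝ} (ht : 0 < t) :
    Summable fun j : ℕ => l ^ j * t ^ (α * j + p) / Real.Gamma (α * j + p + 1) := by
  set B : ℝ := 2 * (|l| * t ^ α + 1) with hB
  have hB0 : 0 < B := by positivity
  set M : ℝ := B ^ (1 / α) with hM
  have hM0 : 0 < M := by positivity
  have hMα : M ^ α = B := by
    rw [hM, ← rpow_mul hB0.le, one_div, inv_mul_cancel₀ hα.ne', rpow_one]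
  refine Summable.of_norm_bounded_eventually_nat
    (g := fun j : ℕ => t ^ p / (M ^ p * Real.exp (-M)) * (1 / 2 : ℝ) ^ j)
    ((summable_geometric_of_lt_one (by norm_num) (by norm_num)).mul_left _) ?_
  have hev : ∀ᶠ j : ℕ in Filter.atTop, -p / α ≤ (j : ℝ) :=
    tendsto_natCast_atTop_atTop.eventually_ge_atTop _
  filter_upwards [hev] with j hj
  have hj' : 0 ≤ α * j + p := by
    rw [div_le_iff₀ hα] at hj
    nlinarith
  have hG := rpow_mul_exp_neg_le_Gamma hM0 (x := α * j + p + 1) (by linarith)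
  rw [add_sub_cancel_right] at hG
  have hpow : ∀ s : ℝ, 0 < s → s ^ (α * j + p) = (s ^ α) ^ j * s ^ p := fun s hs => by
    rw [rpow_add hs, rpow_mul hs.le, rpow_natCast]
  rw [norm_div, norm_mul, norm_pow, Real.norm_eq_abs, Real.norm_eq_abs, Real.norm_eq_abs,
    abs_of_pos (rpow_pos_of_pos ht _), abs_of_pos (Real.Gamma_pos_of_pos (by linarith))]
  calc |l| ^ j * t ^ (α * j + p) / Real.Gamma (α * j + p + 1)
      ≤ |l| ^ j * t ^ (α * j + p) / (M ^ (α * j + p) * Real.exp (-M)) := by gcongr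
    _ = t ^ p / (M ^ p * Real.exp (-M)) * ((|l| * t ^ α) / B) ^ j := by
        rw [hpow t ht, hpow M hM0, hMα, div_pow, mul_pow]
        ring
    _ ≤ t ^ p / (M ^ p * Real.exp (-M)) * (1 / 2 : ℝ) ^ j := by
        have h : |l| * t ^ α / B ≤ 1 / 2 := by
          rw [div_le_iff₀ hB0, hB]
          linarith
        gcongr

lemma hasDerivAt_rpow_div_Gamma (q : ℝ) {t : ℝ} (ht : 0 < t) :
    HasDerivAt (fun s : ℝ => s ^ q / Real.Gamma (q + 1)) (t ^ (q - 1) / Real.Gamma q) t := by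
  refine ((Real.hasDerivAt_rpow_const (Or.inl ht.ne')).div_const _).congr_deriv ?_
  rcases eq_or_ne q 0 with rfl | hq
  · simp
  · rw [Real.Gamma_add_one hq, mul_div_mul_left _ _ hq]

lemma hasDerivAt_mittagLefflerSeries {α : ℝ} (hα : 0 < α) (l p : ℝ) {t : ℝ} (ht : 0 < t) :
    HasDerivAt (mittagLefflerSeries α l p) (mittagLefflerSeries α l (p - 1) t) t := by
  have hmem : t ∈ Ioo (t / 2) (2 * t) := ⟨by linarith, by linarith⟩
  unfold mittagLefflerSeries
  refine hasDerivAt_tsum_of_isPreconnected (t := Ioo (t / 2) (2 * t)) (y₀ := t)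
    (g := fun (j : ℕ) (s : ℝ) => l ^ j * s ^ (α * j + p) / Real.Gamma (α * j + p + 1))
    (g' := fun (j : ℕ) (s : ℝ) =>
      l ^ j * s ^ (α * j + (p - 1)) / Real.Gamma (α * j + (p - 1) + 1))
    (u := fun j : ℕ => ‖l ^ j * (t / 2) ^ (α * j + (p - 1)) / Real.Gamma (α * j + (p - 1) + 1)‖
      + ‖l ^ j * (2 * t) ^ (α * j + (p - 1)) / Real.Gamma (α * j + (p - 1) + 1)‖)
    ((summable_mittagLefflerSeries hα l (p - 1) (half_pos ht)).norm.add
      (summable_mittagLefflerSeries hα l (p - 1) (by positivity : 0 < 2 * t)).norm)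
    isOpen_Ioo isPreconnected_Ioo (fun j y hy => ?_) (fun j y hy => ?_) hmem
    (summable_mittagLefflerSeries hα l p ht) hmem
  · have hy0 : 0 < y := by linarith [hy.1]
    have := (hasDerivAt_rpow_div_Gamma (α * j + p) hy0).const_mul (l ^ j)
    simp only [← mul_div_assoc] at this
    refine this.congr_deriv ?_
    rw [show α * j + (p - 1) + 1 = α * j + p by ring,
      show α * j + (p - 1) = α * j + p - 1 by ring]
  · have hy0 : 0 < y := by linarith [hy.1]
    have h2 : 0 < t / 2 := half_pos ht
    simp only [norm_div, norm_mul, ← add_div, ← mul_add]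
    gcongr
    rw [Real.norm_of_nonneg (by positivity), Real.norm_of_nonneg (by positivity),
      Real.norm_of_nonneg (by positivity)]
    rcases le_total 0 (α * j + (p - 1)) with hq | hq
    · have := rpow_le_rpow hy0.le hy.2.le hq
      have : 0 ≤ (t / 2) ^ (α * j + (p - 1)) := by positivity
      linarith
    · have := rpow_le_rpow_of_nonpos h2 hy.1.le hq
      have : 0 ≤ (2 * t) ^ (α * j + (p - 1)) := by positivity
      linarith

lemma integral_rpow_mul_sub_rpow {p r a : ℝ} (hp : 0 < p) (hr : 0 < r) (ha : 0 < a) :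
    ∫ s in (0 : ℝ)..a, s ^ (p - 1) * (a - s) ^ (r - 1) =
      a ^ (p + r - 1) * (Real.Gamma p * Real.Gamma r / Real.Gamma (p + r)) := by
  have h := Complex.betaIntegral_scaled p r ha
  rw [Complex.betaIntegral_eq_Gamma_mul_div _ _ (by simpa) (by simpa), ← Complex.ofReal_add,
    Complex.Gamma_ofReal, Complex.Gamma_ofReal, Complex.Gamma_ofReal] at h
  apply Complex.ofReal_injective
  rw [← intervalIntegral.integral_ofReal]
  push_cast [Complex.ofReal_cpow ha.le]
  rw [← Complex.ofReal_add, ← h]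
  refine intervalIntegral.integral_congr fun s hs => ?_
  rw [uIcc_of_le ha.le] at hs
  rw [Complex.ofReal_cpow hs.1, Complex.ofReal_cpow (sub_nonneg.2 hs.2)]
  push_cast
  rfl

lemma intervalIntegrable_rpow_mul_sub_rpow {p r a : ℝ} (hp : 0 < p) (hr : 0 < r) (ha : 0 < a) :
    IntervalIntegrable (fun s => s ^ (p - 1) * (a - s) ^ (r - 1)) volume 0 a := by
  apply intervalIntegral.intervalIntegrable_of_integral_ne_zero
  rw [integral_rpow_mul_sub_rpow hp hr ha]
  have := Real.Gamma_pos_of_pos hp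
  have := Real.Gamma_pos_of_pos hr
  have := Real.Gamma_pos_of_pos (add_pos hp hr)
  positivity

lemma intervalIntegrable_mittagLefflerSeries_mul {α l p r t : ℝ} (hα : 0 < α) (hp : -1 < p)
    (hr : 0 < r) (ht : 0 < t) :
    IntervalIntegrable (fun s => mittagLefflerSeries α l p s * (t - s) ^ (r - 1)) volume 0 t := by
  have hb := (intervalIntegrable_rpow_mul_sub_rpow (p := p + 1) (by linarith) hr ht).mul_const
    (∑' j : ℕ, ‖l ^ j * t ^ (α * j + p) / Real.Gamma (α * j + p + 1)‖ / t ^ p)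
  rw [intervalIntegrable_iff_integrableOn_Ioo_of_le ht.le] at hb ⊢
  refine Integrable.mono' hb (ContinuousOn.aestronglyMeasurable ?_ measurableSet_Ioo) ?_
  · intro s hs
    refine ContinuousAt.continuousWithinAt ?_
    refine (hasDerivAt_mittagLefflerSeries hα l p hs.1).continuousAt.mul ?_
    exact ContinuousAt.rpow_const (by fun_prop) (Or.inl (sub_pos.2 hs.2).ne')
  · filter_upwards [ae_restrict_mem measurableSet_Ioo] with s hs
    have hs0 : 0 < s := hs.1
    have hst : 0 < t - s := sub_pos.2 hs.2
    rw [norm_mul, Real.norm_of_nonneg (rpow_nonneg hst.le _), add_sub_cancel_right,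
      mul_right_comm]
    gcongr
    rw [← tsum_mul_left]
    refine tsum_of_norm_bounded
      (((summable_mittagLefflerSeries hα l p ht).norm.div_const _).mul_left _).hasSum fun j => ?_
    rw [norm_div, norm_div, norm_mul, norm_mul, Real.norm_of_nonneg (rpow_nonneg hs0.le _),
      Real.norm_of_nonneg (rpow_nonneg ht.le _), rpow_add hs0, rpow_add ht]
    calc ‖l ^ j‖ * (s ^ (α * j) * s ^ p) / ‖Real.Gamma (α * j + p + 1)‖
        ≤ ‖l ^ j‖ * (t ^ (α * j) * s ^ p) / ‖Real.Gamma (α * j + p + 1)‖ := by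
          gcongr
          exact hs.2.le
      _ = _ := by field_simp

lemma integral_mittagLefflerSeries_mul {α l p r t : ℝ} (hα : 0 < α) (hp : -1 < p)
    (hr : 0 < r) (ht : 0 < t) :
    ∫ s in (0 : ℝ)..t, mittagLefflerSeries α l p s * (t - s) ^ (r - 1) =
      Real.Gamma r * mittagLefflerSeries α l (p + r) t := by
  have hpos : ∀ j : ℕ, 0 < α * j + p + 1 := fun j => by
    have : 0 ≤ α * j := by positivity
    linarith
  have hG : ∀ j : ℕ, Real.Gamma (α * j + p + 1) ≠ 0 := fun j =>
    (Real.Gamma_pos_of_pos (hpos j)).ne'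
  have hI : ∀ (c : ℝ) (j : ℕ), ∫ s in Ioc 0 t,
      c ^ j / Real.Gamma (α * j + p + 1) * (s ^ (α * j + p + 1 - 1) * (t - s) ^ (r - 1)) =
      Real.Gamma r * (c ^ j * t ^ (α * j + (p + r)) / Real.Gamma (α * j + (p + r) + 1)) := by
    intro c j
    rw [integral_const_mul, ← intervalIntegral.integral_of_le ht.le,
      integral_rpow_mul_sub_rpow (hpos j) hr ht,
      show α * j + p + 1 + r - 1 = α * j + (p + r) by ring,
      show α * j + p + 1 + r = α * j + (p + r) + 1 by ring]
    field_simp [hG j]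
  have hsum := hasSum_integral_of_summable_integral_norm (μ := volume.restrict (Ioc 0 t))
    (F := fun (j : ℕ) (s : ℝ) => l ^ j / Real.Gamma (α * j + p + 1) *
      (s ^ (α * j + p + 1 - 1) * (t - s) ^ (r - 1)))
    (fun j => ((intervalIntegrable_iff_integrableOn_Ioc_of_le ht.le).1
      (intervalIntegrable_rpow_mul_sub_rpow (hpos j) hr ht)).const_mul _) ?_
  · rw [intervalIntegral.integral_of_le ht.le, mittagLefflerSeries, ← tsum_mul_left]
    simp only [hI] at hsum
    rw [hsum.tsum_eq]
    refine setIntegral_congr_fun measurableSet_Ioc fun s hs => ?_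
    simp only [mittagLefflerSeries, ← tsum_mul_right]
    refine tsum_congr fun j => ?_
    rw [add_sub_cancel_right]
    ring
  · refine ((summable_mittagLefflerSeries hα |l| (p + r) ht).mul_left (Real.Gamma r)).congr
      fun j => ?_
    rw [← hI]
    refine setIntegral_congr_fun measurableSet_Ioc fun s hs => ?_
    have h1 : 0 ≤ t - s := sub_nonneg.2 hs.2
    have h2 : 0 ≤ s := hs.1.le
    simp only [norm_mul, norm_div, norm_pow, Real.norm_eq_abs,
      abs_of_nonneg (rpow_nonneg h1 _), abs_of_nonneg (rpow_nonneg h2 _),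
      abs_of_pos (Real.Gamma_pos_of_pos (hpos j))]

lemma mittagLefflerSeries_neg_natCast {α : ℝ} (hα : 0 < α) (l : ℝ) {k : ℕ} (hk : 1 ≤ k) {t : ℝ}
    (ht : 0 < t) :
    mittagLefflerSeries α l (-k) t = l * mittagLefflerSeries α l (α - k) t := by
  obtain ⟨m, rfl⟩ := Nat.exists_eq_add_of_le' hk
  rw [mittagLefflerSeries, (summable_mittagLefflerSeries hα l _ ht).tsum_eq_zero_add,
    mittagLefflerSeries, ← tsum_mul_left]
  have h0 : Real.Gamma (α * (0 : ℕ) + -((m + 1 : ℕ) : ℝ) + 1) = 0 := by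
    rw [Real.Gamma_eq_zero_iff]
    exact ⟨m, by push_cast; ring⟩
  rw [h0, div_zero, zero_add]
  refine tsum_congr fun j => ?_
  rw [show α * ((j + 1 : ℕ) : ℝ) + -((m + 1 : ℕ) : ℝ) = α * j + (α - (m + 1 : ℕ)) by
    push_cast; ring]
  ring

lemma rpow_mul_mittagLeffler {α : ℝ} (l q : ℝ) {t : ℝ} (ht : 0 < t) :
    t ^ (α - q) * mittagLeffler α (1 + α - q) (l * t ^ α) =
      mittagLefflerSeries α l (α - q) t := by
  rw [mittagLeffler, mittagLefflerSeries, ← tsum_mul_left]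
  refine tsum_congr fun j => ?_
  rw [show α * j + (1 + α - q) = α * j + (α - q) + 1 by ring, rpow_add ht, rpow_mul ht.le,
    rpow_natCast, mul_pow]
  ring

lemma iteratedDeriv_eq_of_hasDerivAt {G : ℕ → ℝ → ℝ}
    (hG : ∀ m, ∀ t, 0 < t → HasDerivAt (G m) (G (m + 1) t) t) (n : ℕ) {t : ℝ} (ht : 0 < t) :
    iteratedDeriv n (G 0) t = G n t := by
  induction n generalizing t with
  | zero => simp
  | succ n ih =>
    have h : iteratedDeriv n (G 0) =ᶠ[nhds t] G n := by
      filter_upwards [lt_mem_nhds ht] with s hs using ih hs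
    rw [iteratedDeriv_succ, h.deriv_eq, (hG n t ht).deriv]

lemma rlKernel_sum_mittagLefflerSeries {ι : Type*} {n : ℕ} {α : ℝ} (hα0 : 0 < α)
    (hn : (n : ℝ) - 1 < α) (hα : α ≤ n) (s : Finset ι) (c l : ι → ℝ) (k : ι → ℕ)
    (hk : ∀ i ∈ s, k i ≤ n) {h : ℝ → ℝ}
    (hh : ∀ t, 0 < t → h t = ∑ i ∈ s, c i * mittagLefflerSeries α (l i) (α - k i) t)
    {t : ℝ} (ht : 0 < t) :
    rlKernel n α h t = ∑ i ∈ s, c i * mittagLefflerSeries α (l i) (n - k i) t := by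
  rw [rlKernel]
  split_ifs with hαn
  · rw [hh t ht, hαn]
  have hr : 0 < (n : ℝ) - α := sub_pos.2 (lt_of_le_of_ne hα hαn)
  have hp : ∀ i ∈ s, -1 < α - k i := fun i hi => by
    have : (k i : ℝ) ≤ n := by exact_mod_cast hk i hi
    linarith
  have hcongr : ∫ y in (0 : ℝ)..t, h y * (t - y) ^ ((n : ℝ) - α - 1) =
      ∫ y in (0 : ℝ)..t, ∑ i ∈ s, c i *
        (mittagLefflerSeries α (l i) (α - k i) y * (t - y) ^ ((n : ℝ) - α - 1)) := by
    refine intervalIntegral.integral_congr_ae (Filter.Eventually.of_forall fun y hy => ?_)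
    rw [uIoc_of_le ht.le] at hy
    rw [hh y hy.1, Finset.sum_mul]
    exact Finset.sum_congr rfl fun i _ => mul_assoc _ _ _
  simp only
  rw [hcongr, intervalIntegral.integral_finsetSum fun i hi =>
    (intervalIntegrable_mittagLefflerSeries_mul hα0 (hp i hi) hr ht).const_mul _, Finset.mul_sum]
  refine Finset.sum_congr rfl fun i hi => ?_
  rw [intervalIntegral.integral_const_mul, integral_mittagLefflerSeries_mul hα0 (hp i hi) hr ht,
    show α - k i + (n - α) = n - k i by ring]
  field_simp [(Real.Gamma_pos_of_pos hr).ne']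

lemma rlDeriv_sum_mittagLefflerSeries {ι : Type*} {n : ℕ} {α : ℝ} (hα0 : 0 < α)
    (hn : (n : ℝ) - 1 < α) (hα : α ≤ n) (s : Finset ι) (c l : ι → ℝ) (k : ι → ℕ)
    (hk : ∀ i ∈ s, k i ∈ Finset.Icc 1 n) {h : ℝ → ℝ}
    (hh : ∀ t, 0 < t → h t = ∑ i ∈ s, c i * mittagLefflerSeries α (l i) (α - k i) t)
    {t : ℝ} (ht : 0 < t) :
    rlDeriv n α h t = ∑ i ∈ s, c i * (l i * mittagLefflerSeries α (l i) (α - k i) t) := by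
  set G : ℕ → ℝ → ℝ := fun m y => ∑ i ∈ s, c i * mittagLefflerSeries α (l i) (n - k i - m) y
    with hG
  have hK : rlKernel n α h =ᶠ[nhds t] G 0 := by
    filter_upwards [lt_mem_nhds ht] with y hy
    rw [rlKernel_sum_mittagLefflerSeries hα0 hn hα s c l k
      (fun i hi => (Finset.mem_Icc.1 (hk i hi)).2) hh hy]
    simp [hG]
  rw [rlDeriv, hK.iteratedDeriv_eq, iteratedDeriv_eq_of_hasDerivAt (fun m y hy => ?_) n ht]
  · refine Finset.sum_congr rfl fun i hi => ?_
    rw [← mittagLefflerSeries_neg_natCast hα0 (l i) (Finset.mem_Icc.1 (hk i hi)).1 ht,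
      show (n : ℝ) - k i - n = -k i by ring]
  · refine HasDerivAt.fun_sum fun i _ => ?_
    rw [show (n : ℝ) - k i - (m + 1 : ℕ) = n - k i - m - 1 by push_cast; ring]
    exact (hasDerivAt_mittagLefflerSeries hα0 (l i) _ hy).const_mul _

/-- `t ↦ t^(α-k) E_{α,1+α-k}(l t^α)`, `1 ≤ k ≤ n`, are eigenfunctions of the Riemann–Liouville
derivative of order `α` with eigenvalue `l`. -/
lemma rlDeriv_mittagLeffler_combination {n : ℕ} {α : ℝ} (hn : (n : ℝ) - 1 < α) (hα : α ≤ n)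
    (c d : ℕ → ℝ) (l m A B : ℝ) {t : ℝ} (ht : 0 < t) :
    rlDeriv n α (fun s =>
        A * ∑ k ∈ Finset.Icc 1 n, c k * s ^ (α - k) * mittagLeffler α (1 + α - k) (l * s ^ α)
        + B * ∑ k ∈ Finset.Icc 1 n, d k * s ^ (α - k) * mittagLeffler α (1 + α - k) (m * s ^ α))
        t =
      l * (A * ∑ k ∈ Finset.Icc 1 n,
        c k * t ^ (α - k) * mittagLeffler α (1 + α - k) (l * t ^ α))
      + m * (B * ∑ k ∈ Finset.Icc 1 n,
        d k * t ^ (α - k) * mittagLeffler α (1 + α - k) (m * t ^ α)) := by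
  rcases Nat.eq_zero_or_pos n with rfl | hn0
  · simp [rlDeriv, rlKernel]
  have hα0 : 0 < α := by
    have : (1 : ℝ) ≤ n := by exact_mod_cast hn0
    linarith
  rw [rlDeriv_sum_mittagLefflerSeries hα0 hn hα
    ((Finset.Icc 1 n).disjSum (Finset.Icc 1 n))
    (Sum.elim (fun k => A * c k) (fun k => B * d k)) (Sum.elim (fun _ => l) (fun _ => m))
    (Sum.elim id id) (by simp [Finset.mem_disjSum]) (fun s hs => ?_) ht]
  · simp only [Finset.sum_disjSum, Sum.elim_inl, Sum.elim_inr, id, Finset.mul_sum,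
      ← rpow_mul_mittagLeffler _ _ ht]
    congr 1 <;> exact Finset.sum_congr rfl fun k _ => by ring
  · simp only [Finset.sum_disjSum, Sum.elim_inl, Sum.elim_inr, id, Finset.mul_sum,
      ← rpow_mul_mittagLeffler _ _ hs]
    congr 1 <;> exact Finset.sum_congr rfl fun k _ => by ring

lemma hasDerivAt_integral_inv_sqrt {I : Set ℝ} (hI : IsOpen I) (hIc : I.OrdConnected) {f : ℝ → ℝ}
    (hfpos : ∀ x ∈ I, 0 < f x) (hf : ContinuousOn f I) {β x : ℝ} (hβ : β ∈ I) (hx : x ∈ I) :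
    HasDerivAt (fun y => ∫ r in β..y, (Real.sqrt (f r))⁻¹) (Real.sqrt (f x))⁻¹ x := by
  have hc : ContinuousOn (fun r => (Real.sqrt (f r))⁻¹) I :=
    hf.sqrt.inv₀ fun r hr => (Real.sqrt_pos.2 (hfpos r hr)).ne'
  exact intervalIntegral.integral_hasDerivAt_right
    ((hc.mono (hIc.uIcc_subset hβ hx)).intervalIntegrable)
    (hc.stronglyMeasurableAtFilter hI x hx) (hc.continuousAt (hI.mem_nhds hx))

/-- The Mittag–Leffler invariant solutions corresponding to the
subalgebra `W₅` of the time-fractional telegraph system with `g = f'/2`. -/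
theorem mittagLeffler_invariant_solutions_W5
    (n : ℕ) (α : ℝ) (hn : (n : ℝ) - 1 < α) (hα : α ≤ n)
    (I : Set ℝ) (hI : IsOpen I) (hIc : I.OrdConnected)
    (f : ℝ → ℝ) (hfpos : ∀ x ∈ I, 0 < f x) (hfs : ContDiffOn ℝ (⊤ : ℕ∞) f I)
    (β : ℝ) (hβ : β ∈ I)
    (ω : ℝ → ℝ) (hω : ∀ x, ω x = ∫ r in β..x, (Real.sqrt (f r))⁻¹)
    (a₁ a₂ : ℝ) (c₁ c₂ : ℕ → ℝ)
    (φ ψ : ℕ → ℝ → ℝ)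
    (hφ : ∀ k t, φ k t = mittagLeffler α (1 + α - k) ((a₁ + a₂) * t ^ α))
    (hψ : ∀ k t, ψ k t = mittagLeffler α (1 + α - k) ((a₂ - a₁) * t ^ α))
    (u v : ℝ → ℝ → ℝ)
    (hu : ∀ x t, u x t = (Real.sqrt (f x))⁻¹ *
      (Real.exp ((a₁ + a₂) * ω x) * ∑ k ∈ Finset.Icc 1 n, c₁ k * t ^ (α - k) * φ k t
        + Real.exp ((a₁ - a₂) * ω x) * ∑ k ∈ Finset.Icc 1 n, c₂ k * t ^ (α - k) * ψ k t))
    (hv : ∀ x t, v x t =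
      Real.exp ((a₁ + a₂) * ω x) * ∑ k ∈ Finset.Icc 1 n, c₁ k * t ^ (α - k) * φ k t
        - Real.exp ((a₁ - a₂) * ω x) * ∑ k ∈ Finset.Icc 1 n, c₂ k * t ^ (α - k) * ψ k t) :
    ∀ x ∈ I, ∀ t ∈ Set.Ioi (0:ℝ),
      rlDeriv n α (fun s => u x s) t = deriv (fun y => v y t) x ∧
      rlDeriv n α (fun s => v x s) t
        = f x * deriv (fun y => u y t) x + deriv f x / 2 * u x t := by
  intro x hx t ht
  have hfd : DifferentiableAt ℝ f x :=
    (hfs.contDiffAt (hI.mem_nhds hx)).differentiableAt (by simp)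
  have hfx := hfpos x hx
  have hs : 0 < Real.sqrt (f x) := Real.sqrt_pos.2 hfx
  have hss : Real.sqrt (f x) * Real.sqrt (f x) = f x := Real.mul_self_sqrt hfx.le
  have hωd : HasDerivAt ω (Real.sqrt (f x))⁻¹ x := by
    rw [funext hω]
    exact hasDerivAt_integral_inv_sqrt hI hIc hfpos hfs.continuousOn hβ hx
  have he : ∀ a : ℝ, HasDerivAt (fun y => Real.exp (a * ω y))
      (Real.exp (a * ω x) * (a * (Real.sqrt (f x))⁻¹)) x := fun a => (hωd.const_mul a).exp
  set P : ℝ := ∑ k ∈ Finset.Icc 1 n, c₁ k * t ^ (α - k) * φ k t with hP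
  set Q : ℝ := ∑ k ∈ Finset.Icc 1 n, c₂ k * t ^ (α - k) * ψ k t with hQ
  have hrl : ∀ A B : ℝ, rlDeriv n α (fun s =>
      A * ∑ k ∈ Finset.Icc 1 n, c₁ k * s ^ (α - k) * φ k s
      + B * ∑ k ∈ Finset.Icc 1 n, c₂ k * s ^ (α - k) * ψ k s) t =
      (a₁ + a₂) * (A * P) + (a₂ - a₁) * (B * Q) := fun A B => by
    simp only [hP, hQ, hφ, hψ]
    exact rlDeriv_mittagLeffler_combination hn hα c₁ c₂ _ _ A B ht
  have hvd : HasDerivAt (fun y => v y t)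
      (Real.exp ((a₁ + a₂) * ω x) * ((a₁ + a₂) * (Real.sqrt (f x))⁻¹) * P
        - Real.exp ((a₁ - a₂) * ω x) * ((a₁ - a₂) * (Real.sqrt (f x))⁻¹) * Q) x := by
    simp only [hv]
    exact ((he _).mul_const P).sub ((he _).mul_const Q)
  have hud : HasDerivAt (fun y => u y t)
      (-(deriv f x / (2 * Real.sqrt (f x))) / Real.sqrt (f x) ^ 2 *
          (Real.exp ((a₁ + a₂) * ω x) * P + Real.exp ((a₁ - a₂) * ω x) * Q)
        + (Real.sqrt (f x))⁻¹ *
          (Real.exp ((a₁ + a₂) * ω x) * ((a₁ + a₂) * (Real.sqrt (f x))⁻¹) * P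
            + Real.exp ((a₁ - a₂) * ω x) * ((a₁ - a₂) * (Real.sqrt (f x))⁻¹) * Q)) x := by
    simp only [hu]
    exact ((hfd.hasDerivAt.sqrt hfx.ne').inv hs.ne').mul
      (((he _).mul_const P).add ((he _).mul_const Q))
  constructor
  · have hu' : (fun s => u x s) = fun s =>
        ((Real.sqrt (f x))⁻¹ * Real.exp ((a₁ + a₂) * ω x)) *
          ∑ k ∈ Finset.Icc 1 n, c₁ k * s ^ (α - k) * φ k s
        + ((Real.sqrt (f x))⁻¹ * Real.exp ((a₁ - a₂) * ω x)) *
          ∑ k ∈ Finset.Icc 1 n, c₂ k * s ^ (α - k) * ψ k s := by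
      funext s
      rw [hu]
      ring
    rw [hu', hrl, hvd.deriv]
    ring
  · have hv' : (fun s => v x s) = fun s =>
        Real.exp ((a₁ + a₂) * ω x) * ∑ k ∈ Finset.Icc 1 n, c₁ k * s ^ (α - k) * φ k s
        + (-Real.exp ((a₁ - a₂) * ω x)) *
          ∑ k ∈ Finset.Icc 1 n, c₂ k * s ^ (α - k) * ψ k s := by
      funext s
      rw [hv]
      ring
    rw [hv', hrl, hud.deriv, hu x t, ← hP, ← hQ]
    generalize Real.sqrt (f x) = r at hs hss ⊢
    rw [← hss]
    field_simp
    ring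
end
end

section
/- Let n ∈ ℕ with n ≥ 2, let 1 < α ≤ n with n−1 < α, let I ⊆ ℝ be an open interval, f : I → (0,∞) smooth, β ∈ I, λ₁ ∈ ℝ, λ₂ ∈ ℝ with λ₂ ≠ 0, suppose ω_{λ₁}(x) > 0 for all x ∈ I and g(x) = λ₂ √(f(x))/ω_{λ₁}(x) + f'(x)/2, let a ∈ ℝ and c_{k,1}, c_{k,2} ∈ ℝ for k = 1,…,n, and assume no Gamma factor in the numerators of the series below is evaluated at a pole. Define for z > 0: φ(z) = Σ_{k=1}^n c_{k,1} z^{α−k} ₃Ψ₁[4z^{2α} | (1−a/2−k/(2α),1), (1/2−(a+λ₂)/2−k/(2α),1), (1,1); (1+α−k,2α)] − 2 Σ_{k=1}^n c_{k,2} z^{2α−k} ₃Ψ₁[4z^{2α} | (3/2−a/2−k/(2α),1), (1−(a+λ₂)/2−k/(2α),1), (1,1); (1+2α−k,2α)], and ψ(z) = −2 Σ_{k=1}^n c_{k,1} z^{2α−k} ₃Ψ₁[4z^{2α} | (1−a/2−k/(2α),1), (3/2−(a+λ₂)/2−k/(2α),1), (1,1); (1+2α−k,2α)] + Σ_{k=1}^n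 c_{k,2} z^{α−k} ₃Ψ₁[4z^{2α} | (1/2−a/2−k/(2α),1), (1−(a+λ₂)/2−k/(2α),1), (1,1); (1+α−k,2α)]. Then u(x,t) = f(x)^{−1/2} ω_{λ₁}(x)^a φ(ω_{λ₁}(x)^{−1/α} t) and v(x,t) = ω_{λ₁}(x)^a ψ(ω_{λ₁}(x)^{−1/α} t) satisfy ∂^α_t u = ∂_x v and ∂^α_t v = f(x) ∂_x u + g(x) u on I × (0,∞). -/
open MeasureTheory Real Set

noncomputable section

/-- The generalized Wright function
`ₚΨ_q[z | (a᷈,A᷈); (b᷈,B᷈)] = Σ_{k≥0} (∏ᵢ Γ(aᵢ+Aᵢk) / ∏ⱼ Γ(bⱼ+Bⱼk)) zᵏ/k!`. -/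
def genWright {p q : ℕ} (a A : Fin p → ℝ) (b B : Fin q → ℝ) (z : ℝ) : ℝ :=
  ∑' k : ℕ, ((∏ i, Real.Gamma (a i + A i * k)) / ∏ j, Real.Gamma (b j + B j * k))
    * z ^ k / (k.factorial : ℝ)

/-- The fractional power series `Σ_j e_j t^(c + d j) / Γ(c + d j + 1)`. -/
def gammaSeries (e : ℕ → ℝ) (c d t : ℝ) : ℝ :=
  ∑' j : ℕ, e j / Real.Gamma (c + d * j + 1) * t ^ (c + d * j)

/-- For every `c`, the series `Σ_j e_j y^j / Γ(c + d j + 1)` is absolutely convergent on `ℝ`. -/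
def GammaSummable (e : ℕ → ℝ) (d : ℝ) : Prop :=
  ∀ c r : ℝ, 0 ≤ r → Summable fun j : ℕ => |e j / Real.Gamma (c + d * j + 1)| * r ^ j

lemma rpow_add_mul_natCast {y : ℝ} (hy : 0 < y) (c d : ℝ) (j : ℕ) :
    y ^ (c + d * j) = y ^ c * (y ^ d) ^ j := by
  rw [Real.rpow_add hy, Real.rpow_mul hy.le, Real.rpow_natCast]

lemma inv_Gamma_eq_self_mul (s : ℝ) : (Real.Gamma s)⁻¹ = s * (Real.Gamma (s + 1))⁻¹ := by
  rcases eq_or_ne s 0 with rfl | hs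
  · simp
  · rw [Real.Gamma_add_one hs, mul_inv, mul_inv_cancel_left₀ hs]

lemma GammaSummable.mul_pow {e : ℕ → ℝ} {d : ℝ} (he : GammaSummable e d) {ρ : ℝ} (hρ : 0 ≤ ρ) :
    GammaSummable (fun j => e j * ρ ^ j) d := by
  intro c r hr
  refine (he c (ρ * r) (by positivity)).congr fun j => ?_
  rw [mul_div_right_comm, abs_mul, abs_of_nonneg (pow_nonneg hρ j), _root_.mul_pow]
  ring

lemma GammaSummable.summable {e : ℕ → ℝ} {d : ℝ} (he : GammaSummable e d) (c : ℝ) {t : ℝ}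
    (ht : 0 < t) : Summable fun j : ℕ => e j / Real.Gamma (c + d * j + 1) * t ^ (c + d * j) := by
  refine Summable.of_norm (((he c (t ^ d) (by positivity)).mul_left (t ^ c)).congr fun j => ?_)
  rw [rpow_add_mul_natCast ht, norm_mul, Real.norm_eq_abs, Real.norm_eq_abs,
    abs_of_pos (show 0 < t ^ c * (t ^ d) ^ j by positivity)]
  ring

lemma rpow_le_add_of_mem_Icc {y l u : ℝ} (hl : 0 < l) (hy : y ∈ Icc l u) (c : ℝ) :
    y ^ c ≤ l ^ c + u ^ c := by
  have hy0 : 0 < y := hl.trans_le hy.1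
  have hu0 : 0 < u := hy0.trans_le hy.2
  rcases le_total 0 c with hc | hc
  · have := Real.rpow_le_rpow hy0.le hy.2 hc
    have : 0 < l ^ c := by positivity
    linarith
  · have := Real.rpow_le_rpow_of_nonpos hl hy.1 hc
    have : 0 < u ^ c := by positivity
    linarith

lemma GammaSummable.hasDerivAt {e : ℕ → ℝ} {d : ℝ} (hd : 0 ≤ d) (he : GammaSummable e d) (c : ℝ)
    {t : ℝ} (ht : 0 < t) :
    HasDerivAt (gammaSeries e c d) (gammaSeries e (c - 1) d t) t := by
  have key := hasDerivAt_tsum_of_isPreconnected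
    (g := fun (j : ℕ) y => e j / Real.Gamma (c + d * j + 1) * y ^ (c + d * j))
    (g' := fun (j : ℕ) y => e j / Real.Gamma (c - 1 + d * j + 1) * y ^ (c - 1 + d * j))
    (u := fun j => ((t / 2) ^ (c - 1) + (2 * t) ^ (c - 1)) *
      (|e j / Real.Gamma (c - 1 + d * j + 1)| * ((2 * t) ^ d) ^ j))
    (t := Ioo (t / 2) (2 * t)) (y₀ := t) (y := t)
    ((he (c - 1) _ (by positivity)).mul_left _) isOpen_Ioo isPreconnected_Ioo
    (fun j y hy => ?_) (fun j y hy => ?_) ⟨by linarith, by linarith⟩ (he.summable c ht)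
    ⟨by linarith, by linarith⟩
  · exact key
  · have hy0 : 0 < y := lt_trans (by positivity) hy.1
    refine ((Real.hasDerivAt_rpow_const (p := c + d * j) (Or.inl hy0.ne')).const_mul
      (e j / Real.Gamma (c + d * j + 1))).congr_deriv ?_
    rw [show c - 1 + d * j + 1 = c + d * j by ring, div_eq_mul_inv, div_eq_mul_inv,
      inv_Gamma_eq_self_mul (c + d * j),
      show c - 1 + d * j = c + d * j - 1 by ring]
    ring
  · have hy0 : 0 < y := lt_trans (by positivity) hy.1
    rw [rpow_add_mul_natCast hy0, norm_mul, Real.norm_eq_abs, Real.norm_eq_abs,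
      abs_of_pos (show 0 < y ^ (c - 1) * (y ^ d) ^ j by positivity)]
    have h1 := rpow_le_add_of_mem_Icc (show 0 < t / 2 by positivity) ⟨hy.1.le, hy.2.le⟩ (c - 1)
    have h2 : (y ^ d) ^ j ≤ ((2 * t) ^ d) ^ j :=
      pow_le_pow_left₀ (by positivity) (Real.rpow_le_rpow hy0.le hy.2.le hd) j
    calc _ = (y ^ (c - 1)) * (|e j / Real.Gamma (c - 1 + d * j + 1)| * (y ^ d) ^ j) := by ring
      _ ≤ _ := by gcongr

lemma integral_rpow_mul_sub_rpow_s14 {μ γ t : ℝ} (hμ : -1 < μ) (hγ : 0 < γ) (ht : 0 < t) :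
    ∫ s in (0 : ℝ)..t, s ^ μ * (t - s) ^ (γ - 1) =
      t ^ (μ + γ) * (Real.Gamma (μ + 1) * Real.Gamma γ / Real.Gamma (μ + 1 + γ)) := by
  have h := Complex.betaIntegral_scaled ((μ + 1 : ℝ) : ℂ) ((γ : ℝ) : ℂ) ht
  have hB := Complex.betaIntegral_eq_Gamma_mul_div ((μ + 1 : ℝ) : ℂ) ((γ : ℝ) : ℂ)
    (by rw [Complex.ofReal_re]; linarith) (by rwa [Complex.ofReal_re])
  rw [hB, ← Complex.ofReal_add, Complex.Gamma_ofReal, Complex.Gamma_ofReal,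
    Complex.Gamma_ofReal] at h
  have hL : ∫ s in (0 : ℝ)..t, (s : ℂ) ^ (((μ + 1 : ℝ) : ℂ) - 1) *
      ((t : ℂ) - s) ^ (((γ : ℝ) : ℂ) - 1) =
      ((∫ s in (0 : ℝ)..t, s ^ μ * (t - s) ^ (γ - 1) : ℝ) : ℂ) := by
    rw [← intervalIntegral.integral_ofReal]
    refine intervalIntegral.integral_congr fun s hs => ?_
    rw [uIcc_of_le ht.le] at hs
    have h2 : 0 ≤ t - s := by linarith [hs.2]
    simp only [Complex.ofReal_mul]
    rw [Complex.ofReal_cpow hs.1, Complex.ofReal_cpow h2]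
    push_cast
    ring_nf
  rw [hL] at h
  have h3 : (t : ℂ) ^ (((μ + 1 + γ : ℝ) : ℂ) - 1) = ((t ^ (μ + γ) : ℝ) : ℂ) := by
    rw [Complex.ofReal_cpow ht.le]
    push_cast
    ring_nf
  rw [h3] at h
  exact_mod_cast h

lemma intervalIntegrable_rpow_mul_sub_rpow_s14 {μ γ t : ℝ} (hμ : -1 < μ) (hγ : 0 < γ) (ht : 0 < t) :
    IntervalIntegrable (fun s => s ^ μ * (t - s) ^ (γ - 1)) volume 0 t := by
  refine intervalIntegral.intervalIntegrable_of_integral_ne_zero ?_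
  rw [integral_rpow_mul_sub_rpow_s14 hμ hγ ht]
  have h1 := Real.Gamma_pos_of_pos (show 0 < μ + 1 by linarith)
  have h2 := Real.Gamma_pos_of_pos hγ
  have h3 := Real.Gamma_pos_of_pos (show 0 < μ + 1 + γ by linarith)
  positivity

lemma norm_gammaSeries_term_le {e : ℕ → ℝ} {c d γ t s : ℝ} (hd : 0 ≤ d) (hs : s ∈ Ioc 0 t)
    (j : ℕ) :
    ‖e j / Real.Gamma (c + d * j + 1) * s ^ (c + d * j) * (t - s) ^ (γ - 1)‖ ≤
      |e j / Real.Gamma (c + d * j + 1)| * (t ^ d) ^ j * (s ^ c * (t - s) ^ (γ - 1)) := by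
  have hs0 : 0 < s := hs.1
  have h1 : 0 ≤ (t - s) ^ (γ - 1) := Real.rpow_nonneg (by linarith [hs.2]) _
  have h2 : (s ^ d) ^ j ≤ (t ^ d) ^ j :=
    pow_le_pow_left₀ (by positivity) (Real.rpow_le_rpow hs0.le hs.2 hd) j
  rw [norm_mul, norm_mul, rpow_add_mul_natCast hs0, Real.norm_of_nonneg h1, Real.norm_eq_abs,
    Real.norm_of_nonneg (show 0 ≤ s ^ c * (s ^ d) ^ j by positivity)]
  calc _ = |e j / Real.Gamma (c + d * j + 1)| * (s ^ d) ^ j * (s ^ c * (t - s) ^ (γ - 1)) := by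
        ring
    _ ≤ _ := by gcongr

lemma GammaSummable.intervalIntegrable {e : ℕ → ℝ} {d : ℝ} (hd : 0 ≤ d) (he : GammaSummable e d)
    {c γ t : ℝ} (hc : -1 < c) (hγ : 0 < γ) (ht : 0 < t) :
    IntervalIntegrable (fun s => gammaSeries e c d s * (t - s) ^ (γ - 1)) volume 0 t := by
  have hI := intervalIntegrable_rpow_mul_sub_rpow_s14 hc hγ ht
  rw [intervalIntegrable_iff_integrableOn_Ioc_of_le ht.le] at hI ⊢
  have hsum := he c (t ^ d) (by positivity)
  refine Integrable.mono' (hI.const_mul (∑' j : ℕ, |e j / Real.Gamma (c + d * j + 1)| * (t ^ d) ^ j))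
    (AEStronglyMeasurable.mul ?_ ?_) ?_
  · refine ContinuousOn.aestronglyMeasurable (fun s hs => ?_) measurableSet_Ioc
    exact (he.hasDerivAt hd c hs.1).continuousAt.continuousWithinAt
  · exact Measurable.aestronglyMeasurable (by fun_prop)
  · refine (ae_restrict_iff' measurableSet_Ioc).2 (Filter.Eventually.of_forall fun s hs => ?_)
    rw [gammaSeries, ← tsum_mul_right, ← tsum_mul_right]
    exact tsum_of_norm_bounded (hsum.mul_right _).hasSum
      fun j => norm_gammaSeries_term_le hd hs j

lemma GammaSummable.integral {e : ℕ → ℝ} {d : ℝ} (hd : 0 ≤ d) (he : GammaSummable e d)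
    {c γ t : ℝ} (hc : -1 < c) (hγ : 0 < γ) (ht : 0 < t) :
    ∫ s in (0 : ℝ)..t, gammaSeries e c d s * (t - s) ^ (γ - 1) =
      Real.Gamma γ * gammaSeries e (c + γ) d t := by
  have hsum := he c (t ^ d) (by positivity)
  have key := intervalIntegral.hasSum_integral_of_dominated_convergence (μ := volume)
    (a := 0) (b := t)
    (F := fun (j : ℕ) s => e j / Real.Gamma (c + d * j + 1) * s ^ (c + d * j) * (t - s) ^ (γ - 1))
    (f := fun s => gammaSeries e c d s * (t - s) ^ (γ - 1))
    (fun j s => |e j / Real.Gamma (c + d * j + 1)| * (t ^ d) ^ j * (s ^ c * (t - s) ^ (γ - 1)))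
    (fun j => Measurable.aestronglyMeasurable (by fun_prop))
    (fun j => Filter.Eventually.of_forall fun s hs => ?_)
    (Filter.Eventually.of_forall fun s hs => hsum.mul_right _) ?_
    (Filter.Eventually.of_forall fun s hs => ?_)
  · rw [← key.tsum_eq, gammaSeries, ← tsum_mul_left]
    refine tsum_congr fun j => ?_
    have hμ : -1 < c + d * j := by
      have : 0 ≤ d * j := by positivity
      linarith
    simp_rw [mul_assoc]
    rw [intervalIntegral.integral_const_mul, integral_rpow_mul_sub_rpow_s14 hμ hγ ht]
    have h1 := (Real.Gamma_pos_of_pos (show 0 < c + d * j + 1 by linarith)).ne'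
    rw [show c + γ + d * j = c + d * j + γ by ring,
      show c + d * j + γ + 1 = c + d * j + 1 + γ by ring]
    field_simp
  · rw [uIoc_of_le ht.le] at hs
    exact norm_gammaSeries_term_le hd hs j
  · simp_rw [tsum_mul_right]
    exact (intervalIntegrable_rpow_mul_sub_rpow_s14 hc hγ ht).const_mul _
  · rw [uIoc_of_le ht.le] at hs
    exact (he.summable c hs.1).hasSum.mul_right _

/-- `h` has, on `(0, ∞)`, the Riemann–Liouville derivative `h'` of order `α`, obtained from a chain
of successive classical derivatives starting at the Riemann–Liouville kernel. -/
def HasRLDeriv (n : ℕ) (α : ℝ) (h h' : ℝ → ℝ) : Prop :=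
  (α ≠ n → ∀ t, 0 < t →
    IntervalIntegrable (fun s => h s * (t - s) ^ ((n : ℝ) - α - 1)) volume 0 t) ∧
  ∃ F : ℕ → ℝ → ℝ, (∀ t, 0 < t → rlKernel n α h t = F 0 t) ∧
    (∀ m t, 0 < t → HasDerivAt (F m) (F (m + 1) t) t) ∧ ∀ t, 0 < t → F n t = h' t

lemma HasRLDeriv.rlDeriv_eq {n : ℕ} {α : ℝ} {h h' : ℝ → ℝ} (H : HasRLDeriv n α h h') {t : ℝ}
    (ht : 0 < t) : rlDeriv n α h t = h' t := by
  obtain ⟨-, F, h0, hF, hn⟩ := H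
  have key : ∀ m t, 0 < t → iteratedDeriv m (rlKernel n α h) t = F m t := by
    intro m
    induction m with
    | zero => simpa using h0
    | succ m ih =>
      intro t ht
      rw [iteratedDeriv_succ]
      have : iteratedDeriv m (rlKernel n α h) =ᶠ[nhds t] F m := by
        filter_upwards [Ioi_mem_nhds ht] with s hs using ih s hs
      rw [this.deriv_eq, (hF m t ht).deriv]
  rw [rlDeriv, key n t ht, hn t ht]

lemma rlKernel_congr {n : ℕ} {α : ℝ} {h k : ℝ → ℝ} (hk : ∀ t, 0 < t → h t = k t) {t : ℝ}
    (ht : 0 < t) : rlKernel n α h t = rlKernel n α k t := by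
  unfold rlKernel
  split_ifs
  · exact hk t ht
  · beta_reduce
    congr 1
    refine intervalIntegral.integral_congr_ae (μ := volume)
      (Filter.Eventually.of_forall fun s hs => ?_)
    rw [uIoc_of_le ht.le] at hs
    rw [hk s hs.1]

lemma HasRLDeriv.congr {n : ℕ} {α : ℝ} {h h' k k' : ℝ → ℝ} (H : HasRLDeriv n α h h')
    (hk : ∀ t, 0 < t → k t = h t) (hk' : ∀ t, 0 < t → k' t = h' t) : HasRLDeriv n α k k' := by
  obtain ⟨hi, F, h0, hF, hn⟩ := H
  refine ⟨fun hα t ht => (hi hα t ht).congr fun s hs => ?_, F, fun t ht => ?_, hF, fun t ht => ?_⟩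
  · rw [uIoc_of_le ht.le] at hs
    simp only [hk s hs.1]
  · rw [rlKernel_congr hk ht, h0 t ht]
  · rw [hn t ht, hk' t ht]

lemma HasRLDeriv.const_mul {n : ℕ} {α : ℝ} {h h' : ℝ → ℝ} (C : ℝ) (H : HasRLDeriv n α h h') :
    HasRLDeriv n α (fun t => C * h t) (fun t => C * h' t) := by
  obtain ⟨hi, F, h0, hF, hn⟩ := H
  refine ⟨fun hα t ht => ?_, fun m t => C * F m t, fun t ht => ?_,
    fun m t ht => (hF m t ht).const_mul C, fun t ht => ?_⟩
  · simpa only [mul_assoc] using (hi hα t ht).const_mul C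
  · change _ = C * F 0 t
    rw [← h0 t ht]
    unfold rlKernel
    split_ifs
    · rfl
    · simp_rw [mul_assoc]
      rw [intervalIntegral.integral_const_mul]
      ring
  · simp only [hn t ht]

lemma HasRLDeriv.add {n : ℕ} {α : ℝ} {h h' k k' : ℝ → ℝ} (H : HasRLDeriv n α h h')
    (K : HasRLDeriv n α k k') : HasRLDeriv n α (fun t => h t + k t) (fun t => h' t + k' t) := by
  obtain ⟨hi, F, h0, hF, hn⟩ := H
  obtain ⟨ki, G, k0, hG, kn⟩ := K
  refine ⟨fun hα t ht => ?_, fun m t => F m t + G m t, fun t ht => ?_,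
    fun m t ht => (hF m t ht).add (hG m t ht), fun t ht => ?_⟩
  · simpa only [add_mul] using (hi hα t ht).add (ki hα t ht)
  · change _ = F 0 t + G 0 t
    rw [← h0 t ht, ← k0 t ht]
    unfold rlKernel
    split_ifs with hα
    · rfl
    · simp_rw [add_mul]
      rw [intervalIntegral.integral_add (hi hα t ht) (ki hα t ht)]
      ring
  · simp only [hn t ht, kn t ht]

lemma HasRLDeriv.zero (n : ℕ) (α : ℝ) : HasRLDeriv n α (fun _ => 0) (fun _ => 0) := by
  refine ⟨fun _ t _ => by simp, fun _ _ => 0, fun t _ => ?_, fun _ t _ => hasDerivAt_const t 0,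
    fun _ _ => rfl⟩
  unfold rlKernel
  split_ifs <;> simp

lemma HasRLDeriv.sum {ι : Type*} {n : ℕ} {α : ℝ} {h h' : ι → ℝ → ℝ} (s : Finset ι)
    (H : ∀ i ∈ s, HasRLDeriv n α (h i) (h' i)) :
    HasRLDeriv n α (fun t => ∑ i ∈ s, h i t) (fun t => ∑ i ∈ s, h' i t) := by
  classical
  induction s using Finset.induction_on with
  | empty => simpa using HasRLDeriv.zero n α
  | insert i s hi ih =>
    simp_rw [Finset.sum_insert hi]
    exact (H i (Finset.mem_insert_self i s)).add
      (ih fun j hj => H j (Finset.mem_insert_of_mem hj))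

lemma GammaSummable.hasRLDeriv {e : ℕ → ℝ} {d : ℝ} (hd : 0 ≤ d) (he : GammaSummable e d)
    {n : ℕ} {α : ℝ} (hα : α ≤ n) {c : ℝ} (hc : -1 < c) :
    HasRLDeriv n α (gammaSeries e c d) (gammaSeries e (c - α) d) := by
  refine ⟨fun hne t ht => he.intervalIntegrable hd hc (sub_pos.2 (lt_of_le_of_ne hα hne)) ht,
    fun m => gammaSeries e (c + (n - α) - m) d, fun t ht => ?_, fun m t ht => ?_, fun t ht => ?_⟩
  · unfold rlKernel
    split_ifs with h
    · simp [h]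
    · have hγ := sub_pos.2 (lt_of_le_of_ne hα h)
      beta_reduce
      rw [he.integral hd hc hγ ht, inv_mul_cancel_left₀ (Real.Gamma_pos_of_pos hγ).ne']
      simp
  · convert he.hasDerivAt hd (c + (n - α) - m) ht using 2
    push_cast
    ring
  · change gammaSeries e (c + (n - α) - n) d t = _
    rw [show c + (n - α) - n = c - α by ring]

lemma gammaSeries_mul_right (e : ℕ → ℝ) (c d : ℝ) {ρ t : ℝ} (hρ : 0 < ρ) (ht : 0 < t) :
    gammaSeries e c d (ρ * t) = ρ ^ c * gammaSeries (fun j => e j * (ρ ^ d) ^ j) c d t := by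
  rw [gammaSeries, gammaSeries, ← tsum_mul_left]
  refine tsum_congr fun j => ?_
  rw [Real.mul_rpow hρ.le ht.le, rpow_add_mul_natCast hρ]
  ring

lemma GammaSummable.hasRLDeriv_comp_mul {e : ℕ → ℝ} {d : ℝ} (hd : 0 ≤ d) (he : GammaSummable e d)
    {n : ℕ} {α : ℝ} (hα : α ≤ n) {c : ℝ} (hc : -1 < c) {ρ : ℝ} (hρ : 0 < ρ) :
    HasRLDeriv n α (fun t => gammaSeries e c d (ρ * t))
      (fun t => ρ ^ α * gammaSeries e (c - α) d (ρ * t)) := by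
  have h := ((he.mul_pow (Real.rpow_nonneg hρ.le d)).hasRLDeriv hd hα hc).const_mul (ρ ^ c)
  refine h.congr (fun t ht => gammaSeries_mul_right e c d hρ ht) fun t ht => ?_
  rw [gammaSeries_mul_right e _ d hρ ht, ← mul_assoc, ← Real.rpow_add hρ, add_sub_cancel]

lemma rpow_mul_Gamma_le_Gamma_add {x δ : ℝ} (hx : 1 < x) (hδ : 0 < δ) :
    (x - 1) ^ δ * Real.Gamma x ≤ Real.Gamma (x + δ) := by
  have hx1 : 0 < x - 1 := by linarith
  have h1 : 0 < 1 + δ := by linarith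
  have hG := Real.Gamma_pos_of_pos (show 0 < x by linarith)
  have hG1 := Real.Gamma_pos_of_pos hx1
  have hGδ := Real.Gamma_pos_of_pos (show 0 < x + δ by linarith)
  have hrec : Real.Gamma x = (x - 1) * Real.Gamma (x - 1) := by
    rw [← Real.Gamma_add_one hx1.ne', sub_add_cancel]
  have h := Real.Gamma_mul_add_mul_le_rpow_Gamma_mul_rpow_Gamma hx1 (show 0 < x + δ by linarith)
    (show 0 < δ / (1 + δ) by positivity) (show 0 < 1 / (1 + δ) by positivity) (by field_simp; ring)
  rw [show δ / (1 + δ) * (x - 1) + 1 / (1 + δ) * (x + δ) = x by field_simp; ring] at h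
  have h2 := Real.rpow_le_rpow hG.le h h1.le
  rw [Real.mul_rpow (by positivity) (by positivity), ← Real.rpow_mul hG1.le,
    ← Real.rpow_mul hGδ.le, div_mul_cancel₀ _ h1.ne', div_mul_cancel₀ _ h1.ne', Real.rpow_one,
    Real.rpow_add hG, Real.rpow_one] at h2
  have h3 : Real.Gamma x ^ δ = (x - 1) ^ δ * Real.Gamma (x - 1) ^ δ := by
    rw [hrec, Real.mul_rpow hx1.le hG1.le]
  rw [h3] at h2
  have h4 : 0 < Real.Gamma (x - 1) ^ δ := by positivity
  refine le_of_mul_le_mul_left ?_ h4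
  linarith

/-- The coefficients `Γ(p + j) Γ(q + j) 4^j`. -/
def gammaCoeff (p q : ℝ) (j : ℕ) : ℝ := Real.Gamma (p + j) * Real.Gamma (q + j) * 4 ^ j

lemma gammaCoeff_comm (p q : ℝ) : gammaCoeff p q = gammaCoeff q p := by
  funext j
  simp only [gammaCoeff]
  ring

lemma gammaCoeff_add_one_left {p : ℝ} (q : ℝ) {j : ℕ} (hp : p + j ≠ 0) :
    gammaCoeff (p + 1) q j = (p + j) * gammaCoeff p q j := by
  rw [gammaCoeff, gammaCoeff, add_right_comm, Real.Gamma_add_one hp]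
  ring

lemma gammaCoeff_succ (p q : ℝ) (j : ℕ) :
    gammaCoeff p q (j + 1) = 4 * gammaCoeff (p + 1) (q + 1) j := by
  rw [gammaCoeff, gammaCoeff, add_right_comm p, add_right_comm q]
  push_cast
  rw [pow_succ, ← add_assoc, ← add_assoc]
  ring

lemma gammaSummable_gammaCoeff (p q : ℝ) {d : ℝ} (hd : 2 < d) :
    GammaSummable (gammaCoeff p q) d := by
  intro c r hr
  refine summable_of_ratio_norm_eventually_le (r := 1 / 2) (by norm_num) ?_
  have hcast : Filter.Tendsto (fun j : ℕ => (j : ℝ)) Filter.atTop Filter.atTop :=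
    tendsto_natCast_atTop_atTop
  filter_upwards [hcast.eventually_gt_atTop |p|, hcast.eventually_gt_atTop |q|,
    hcast.eventually_gt_atTop |c|, ((tendsto_rpow_atTop (show 0 < d - 2 by linarith)).comp
      hcast).eventually_ge_atTop (32 * r)] with j hp hq hc hj
  simp only [Function.comp_apply] at hj
  have hj0 : (0 : ℝ) < j := (abs_nonneg p).trans_lt hp
  have hp' := abs_lt.1 hp
  have hq' := abs_lt.1 hq
  have hc' := abs_lt.1 hc
  have hpj : 0 < p + j := by linarith
  have hqj : 0 < q + j := by linarith
  have hx : (j : ℝ) ≤ c + d * j := by nlinarith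
  have hΓ := Real.Gamma_pos_of_pos (show 0 < c + d * j + 1 by linarith)
  have hle := rpow_mul_Gamma_le_Gamma_add (x := c + d * j + 1) (δ := d) (by linarith) (by linarith)
  rw [add_sub_cancel_right] at hle
  have hle2 : (j : ℝ) ^ d * Real.Gamma (c + d * j + 1) ≤ Real.Gamma (c + d * j + 1 + d) :=
    le_trans (by gcongr) hle
  have hjd : (j : ℝ) ^ d = j ^ (d - 2) * j ^ 2 := by
    rw [← Real.rpow_natCast, ← Real.rpow_add hj0]
    norm_num
  have hjd0 : 0 < (j : ℝ) ^ d := by positivity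
  have hN : 4 * (p + j) * (q + j) * r ≤ 1 / 2 * (j : ℝ) ^ d := by
    have h1 : (p + j) * (q + j) ≤ (2 * j) * (2 * j) := by gcongr <;> linarith
    calc 4 * (p + j) * (q + j) * r = 4 * r * ((p + j) * (q + j)) := by ring
      _ ≤ 4 * r * ((2 * j) * (2 * j)) := by gcongr
      _ = 1 / 2 * (32 * r * (j : ℝ) ^ 2) := by ring
      _ ≤ 1 / 2 * (j : ℝ) ^ d := by rw [hjd]; gcongr
  have hG : gammaCoeff p q (j + 1) = 4 * (p + j) * (q + j) * gammaCoeff p q j := by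
    rw [gammaCoeff_succ, gammaCoeff_add_one_left _ hpj.ne', gammaCoeff_comm,
      gammaCoeff_add_one_left _ hqj.ne', gammaCoeff_comm]
    ring
  have hx2 : c + d * ((j + 1 : ℕ) : ℝ) + 1 = c + d * j + 1 + d := by push_cast; ring
  rw [hx2, hG, Real.norm_of_nonneg (by positivity), Real.norm_of_nonneg (by positivity), abs_div,
    abs_div, abs_of_pos hΓ, abs_of_pos (lt_of_lt_of_le (by positivity) hle2), abs_mul,
    abs_of_pos (show 0 < 4 * (p + j) * (q + j) by positivity), pow_succ]
  calc _ = 4 * (p + j) * (q + j) * r * (|gammaCoeff p q j| * r ^ j) /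
        Real.Gamma (c + d * j + 1 + d) := by ring
    _ ≤ 1 / 2 * (j : ℝ) ^ d * (|gammaCoeff p q j| * r ^ j) /
        ((j : ℝ) ^ d * Real.Gamma (c + d * j + 1)) := by gcongr
    _ = _ := by field_simp

lemma rpow_mul_genWright (p q c d : ℝ) {b z : ℝ} (hb : b = c + 1) (hz : 0 < z) :
    z ^ c * genWright ![p, q, 1] ![1, 1, 1] ![b] ![d] (4 * z ^ d) =
      gammaSeries (gammaCoeff p q) c d z := by
  rw [genWright, gammaSeries, ← tsum_mul_left]
  refine tsum_congr fun j => ?_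
  have hfac : Real.Gamma (1 + j) = (j.factorial : ℝ) := by
    rw [add_comm, Real.Gamma_nat_eq_factorial]
  have h0 : (j.factorial : ℝ) ≠ 0 := by positivity
  simp only [Fin.prod_univ_three, Fin.prod_univ_one, Matrix.cons_val_zero, Matrix.cons_val_one,
    Matrix.cons_val, one_mul, hfac, gammaCoeff]
  rw [rpow_add_mul_natCast hz, hb, add_right_comm c 1, _root_.mul_pow]
  field_simp

lemma gammaSeries_gammaCoeff_euler {α : ℝ} (hα : 1 < α) {p : ℝ} (q : ℝ) {c s z : ℝ}
    (hp : ∀ j : ℕ, p + j ≠ 0) (hs : s - c / α = -2 * p) (hz : 0 < z) :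
    s * gammaSeries (gammaCoeff p q) c (2 * α) z -
        1 / α * (z * gammaSeries (gammaCoeff p q) (c - 1) (2 * α) z) =
      -2 * gammaSeries (gammaCoeff (p + 1) q) c (2 * α) z := by
  have hS := gammaSummable_gammaCoeff p q (show 2 < 2 * α by linarith)
  rw [gammaSeries, gammaSeries, gammaSeries, ← tsum_mul_left, ← tsum_mul_left, ← tsum_mul_left,
    ← tsum_mul_left, ← Summable.tsum_sub ((hS.summable c hz).mul_left _)
      (((hS.summable (c - 1) hz).mul_left _).mul_left _)]
  refine tsum_congr fun j => ?_
  rw [gammaCoeff_add_one_left q (hp j), show c - 1 + 2 * α * j + 1 = c + 2 * α * j by ring,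
    div_eq_mul_inv _ (Real.Gamma (c + 2 * α * j)), inv_Gamma_eq_self_mul (c + 2 * α * j),
    show c - 1 + 2 * α * j = c + 2 * α * j - 1 by ring, Real.rpow_sub_one hz.ne']
  have hp2 : p = -(s - c / α) / 2 := by linarith
  rw [hp2]
  field_simp
  ring

lemma gammaSeries_gammaCoeff_neg_natCast {p q d : ℝ} (hd : 2 < d) {k : ℕ} (hk : 1 ≤ k) {z : ℝ}
    (hz : 0 < z) :
    gammaSeries (gammaCoeff p q) (-k) d z =
      4 * gammaSeries (gammaCoeff (p + 1) (q + 1)) (d - k) d z := by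
  have h0 : Real.Gamma (-k + d * (0 : ℕ) + 1) = 0 := by
    obtain ⟨m, rfl⟩ := Nat.exists_eq_add_of_le hk
    rw [show (-((1 + m : ℕ) : ℝ) + d * (0 : ℕ) + 1) = -(m : ℝ) by push_cast; ring]
    exact Real.Gamma_neg_nat_eq_zero m
  rw [gammaSeries, gammaSeries, ((gammaSummable_gammaCoeff p q hd).summable _ hz).tsum_eq_zero_add,
    h0, ← tsum_mul_left, div_zero, zero_mul, zero_add]
  refine tsum_congr fun j => ?_
  rw [gammaCoeff_succ, show (-k + d * ((j + 1 : ℕ) : ℝ)) = d - k + d * j by push_cast; ring]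
  ring

/-- Linear combinations of the series `gammaSeries` with exponents `α - k + s` and `2 α - k + s`,
`1 ≤ k ≤ n`. -/
def gammaSeriesSum (n : ℕ) (α : ℝ) (w₁ w₂ : ℕ → ℝ) (e₁ e₂ : ℕ → ℕ → ℝ) (s z : ℝ) : ℝ :=
  ∑ k ∈ Finset.Icc 1 n, (w₁ k * gammaSeries (e₁ k) (α - k + s) (2 * α) z +
    w₂ k * gammaSeries (e₂ k) (2 * α - k + s) (2 * α) z)

section

variable {n : ℕ} {α : ℝ} {w₁ w₂ : ℕ → ℝ} {e₁ e₂ : ℕ → ℕ → ℝ}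

lemma hasDerivAt_gammaSeriesSum (hα1 : 1 < α) (h₁ : ∀ k, GammaSummable (e₁ k) (2 * α))
    (h₂ : ∀ k, GammaSummable (e₂ k) (2 * α)) (s : ℝ) {z : ℝ} (hz : 0 < z) :
    HasDerivAt (gammaSeriesSum n α w₁ w₂ e₁ e₂ s)
      (gammaSeriesSum n α w₁ w₂ e₁ e₂ (s - 1) z) z := by
  have hd : 0 ≤ 2 * α := by linarith
  unfold gammaSeriesSum
  refine HasDerivAt.fun_sum fun k _ => ?_
  rw [← add_sub_assoc, ← add_sub_assoc]
  exact (((h₁ k).hasDerivAt hd _ hz).const_mul _).add (((h₂ k).hasDerivAt hd _ hz).const_mul _)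

lemma hasRLDeriv_gammaSeriesSum (hα1 : 1 < α) (hαn : α ≤ n) (hn : (n : ℝ) - 1 < α)
    (h₁ : ∀ k, GammaSummable (e₁ k) (2 * α)) (h₂ : ∀ k, GammaSummable (e₂ k) (2 * α))
    {ρ : ℝ} (hρ : 0 < ρ) :
    HasRLDeriv n α (fun t => gammaSeriesSum n α w₁ w₂ e₁ e₂ 0 (ρ * t))
      (fun t => ρ ^ α * gammaSeriesSum n α w₁ w₂ e₁ e₂ (-α) (ρ * t)) := by
  have hd : 0 ≤ 2 * α := by linarith
  have key : ∀ k ∈ Finset.Icc 1 n, HasRLDeriv n α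
      (fun t => w₁ k * gammaSeries (e₁ k) (α - k) (2 * α) (ρ * t) +
        w₂ k * gammaSeries (e₂ k) (2 * α - k) (2 * α) (ρ * t))
      (fun t => w₁ k * (ρ ^ α * gammaSeries (e₁ k) (α - k - α) (2 * α) (ρ * t)) +
        w₂ k * (ρ ^ α * gammaSeries (e₂ k) (2 * α - k - α) (2 * α) (ρ * t))) := by
    intro k hk
    have hkn : (k : ℝ) ≤ n := by exact_mod_cast (Finset.mem_Icc.1 hk).2
    exact (((h₁ k).hasRLDeriv_comp_mul hd hαn (by linarith) hρ).const_mul _).add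
      (((h₂ k).hasRLDeriv_comp_mul hd hαn (by linarith) hρ).const_mul _)
  refine (HasRLDeriv.sum _ key).congr (fun t _ => ?_) fun t _ => ?_
  · simp only [gammaSeriesSum, add_zero]
  · simp only [gammaSeriesSum, Finset.mul_sum, ← sub_eq_add_neg]
    refine Finset.sum_congr rfl fun k _ => ?_
    ring

end

lemma hasDerivAt_rpow_mul_comp_rpow {ω Φ : ℝ → ℝ} {x ω' Φ' : ℝ} (a α t : ℝ) (hx : 0 < ω x)
    (hω : HasDerivAt ω ω' x) (hΦ : HasDerivAt Φ Φ' (ω x ^ (-(1 / α)) * t)) :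
    HasDerivAt (fun y => ω y ^ a * Φ (ω y ^ (-(1 / α)) * t))
      (ω' * (ω x ^ a * (ω x)⁻¹ * (a * Φ (ω x ^ (-(1 / α)) * t) -
        1 / α * (ω x ^ (-(1 / α)) * t * Φ')))) x := by
  have h1 := hω.rpow_const (p := a) (Or.inl hx.ne')
  have h2 := (hω.rpow_const (p := -(1 / α)) (Or.inl hx.ne')).mul_const t
  refine (h1.mul (HasDerivAt.comp x hΦ h2)).congr_deriv ?_
  rw [Real.rpow_sub_one hx.ne', Real.rpow_sub_one hx.ne']
  simp only [Function.comp_apply]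
  field_simp
  ring

/-- For `α > 1`, the generalized-Wright (`₃Ψ₁`) invariant solutions
of Case 1, item 2, of the time-fractional telegraph system with
`g = λ₂ √f / ω_{λ₁} + f'/2`. -/
theorem genWright_invariant_solutions_case1
    (n : ℕ) (hn2 : 2 ≤ n) (α : ℝ) (hα1 : 1 < α) (hαn : α ≤ n) (hn : (n : ℝ) - 1 < α)
    (I : Set ℝ) (hI : IsOpen I) (hIc : I.OrdConnected)
    (f : ℝ → ℝ) (hfpos : ∀ x ∈ I, 0 < f x) (hfs : ContDiffOn ℝ (⊤ : ℕ∞) f I)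
    (β : ℝ) (hβ : β ∈ I) (lam₁ lam₂ : ℝ) (hlam₂ : lam₂ ≠ 0)
    (ω : ℝ → ℝ) (hω : ∀ x, ω x = (∫ r in β..x, (Real.sqrt (f r))⁻¹) + lam₁)
    (hωpos : ∀ x ∈ I, 0 < ω x)
    (g : ℝ → ℝ)
    (hg : ∀ x ∈ I, g x = lam₂ * Real.sqrt (f x) / ω x + deriv f x / 2)
    (a : ℝ) (c₁ c₂ : ℕ → ℝ)
    -- no Gamma factor in the numerators of the series below is evaluated at a pole
    -- (Mathlib's `Real.Gamma` vanishes exactly at the poles)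
    (hpole : ∀ k ∈ Finset.Icc 1 n, ∀ j : ℕ,
      Real.Gamma (1 - a / 2 - (k : ℝ) / (2 * α) + j) ≠ 0 ∧
      Real.Gamma (1 / 2 - (a + lam₂) / 2 - (k : ℝ) / (2 * α) + j) ≠ 0 ∧
      Real.Gamma (3 / 2 - a / 2 - (k : ℝ) / (2 * α) + j) ≠ 0 ∧
      Real.Gamma (1 - (a + lam₂) / 2 - (k : ℝ) / (2 * α) + j) ≠ 0 ∧
      Real.Gamma (3 / 2 - (a + lam₂) / 2 - (k : ℝ) / (2 * α) + j) ≠ 0 ∧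
      Real.Gamma (1 / 2 - a / 2 - (k : ℝ) / (2 * α) + j) ≠ 0)
    (φ ψ : ℝ → ℝ)
    (hφ : ∀ z, φ z =
      (∑ k ∈ Finset.Icc 1 n, c₁ k * z ^ (α - k) *
        genWright ![1 - a / 2 - (k : ℝ) / (2 * α),
                    1 / 2 - (a + lam₂) / 2 - (k : ℝ) / (2 * α), 1]
          ![1, 1, 1] ![1 + α - k] ![2 * α] (4 * z ^ (2 * α)))
      - 2 * ∑ k ∈ Finset.Icc 1 n, c₂ k * z ^ (2 * α - k) *
        genWright ![3 / 2 - a / 2 - (k : ℝ) / (2 * α),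
                    1 - (a + lam₂) / 2 - (k : ℝ) / (2 * α), 1]
          ![1, 1, 1] ![1 + 2 * α - k] ![2 * α] (4 * z ^ (2 * α)))
    (hψ : ∀ z, ψ z =
      (-2) * (∑ k ∈ Finset.Icc 1 n, c₁ k * z ^ (2 * α - k) *
        genWright ![1 - a / 2 - (k : ℝ) / (2 * α),
                    3 / 2 - (a + lam₂) / 2 - (k : ℝ) / (2 * α), 1]
          ![1, 1, 1] ![1 + 2 * α - k] ![2 * α] (4 * z ^ (2 * α)))
      + ∑ k ∈ Finset.Icc 1 n, c₂ k * z ^ (α - k) *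
        genWright ![1 / 2 - a / 2 - (k : ℝ) / (2 * α),
                    1 - (a + lam₂) / 2 - (k : ℝ) / (2 * α), 1]
          ![1, 1, 1] ![1 + α - k] ![2 * α] (4 * z ^ (2 * α)))
    (u v : ℝ → ℝ → ℝ)
    (hu : ∀ x t, u x t = (Real.sqrt (f x))⁻¹ * ω x ^ a * φ (ω x ^ (-(1 / α)) * t))
    (hv : ∀ x t, v x t = ω x ^ a * ψ (ω x ^ (-(1 / α)) * t)) :
    ∀ x ∈ I, ∀ t ∈ Set.Ioi (0:ℝ),
      rlDeriv n α (fun s => u x s) t = deriv (fun y => v y t) x ∧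
      rlDeriv n α (fun s => v x s) t
        = f x * deriv (fun y => u y t) x + g x * u x t := by
  have hα0 : 0 < α := by linarith
  have hd : 2 < 2 * α := by linarith
  have hne : ∀ {p : ℝ} {j : ℕ}, Real.Gamma (p + j) ≠ 0 → p + j ≠ 0 := fun h h0 =>
    h (by rw [h0, Real.Gamma_zero])
  let A : ℕ → ℝ := fun k => 1 - a / 2 - (k : ℝ) / (2 * α)
  let B : ℕ → ℝ := fun k => 1 / 2 - (a + lam₂) / 2 - (k : ℝ) / (2 * α)
  let C : ℕ → ℝ := fun k => 3 / 2 - a / 2 - (k : ℝ) / (2 * α)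
  let D : ℕ → ℝ := fun k => 1 - (a + lam₂) / 2 - (k : ℝ) / (2 * α)
  let E : ℕ → ℝ := fun k => 3 / 2 - (a + lam₂) / 2 - (k : ℝ) / (2 * α)
  let F : ℕ → ℝ := fun k => 1 / 2 - a / 2 - (k : ℝ) / (2 * α)
  have hCF : ∀ k, C k = F k + 1 := fun k => by simp only [C, F]; ring
  have hEB : ∀ k, E k = B k + 1 := fun k => by simp only [E, B]; ring
  let S : ℝ → ℝ → ℝ := gammaSeriesSum n α c₁ (fun k => -2 * c₂ k)
    (fun k => gammaCoeff (A k) (B k)) (fun k => gammaCoeff (C k) (D k))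
  let R : ℝ → ℝ → ℝ := gammaSeriesSum n α c₂ (fun k => -2 * c₁ k)
    (fun k => gammaCoeff (F k) (D k)) (fun k => gammaCoeff (A k) (E k))
  have hφS : ∀ z, 0 < z → φ z = S 0 z := by
    intro z hz
    simp only [hφ, S, gammaSeriesSum, Finset.mul_sum, ← Finset.sum_sub_distrib]
    refine Finset.sum_congr rfl fun k _ => ?_
    rw [add_zero, add_zero, ← rpow_mul_genWright (A k) (B k) (α - k) (2 * α)
      (b := 1 + α - k) (by ring) hz, ← rpow_mul_genWright (C k) (D k) (2 * α - k) (2 * α)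
      (b := 1 + 2 * α - k) (by ring) hz]
    ring
  have hψR : ∀ z, 0 < z → ψ z = R 0 z := by
    intro z hz
    simp only [hψ, R, gammaSeriesSum, Finset.mul_sum, ← Finset.sum_add_distrib]
    refine Finset.sum_congr rfl fun k _ => ?_
    rw [add_zero, add_zero, ← rpow_mul_genWright (F k) (D k) (α - k) (2 * α)
      (b := 1 + α - k) (by ring) hz, ← rpow_mul_genWright (A k) (E k) (2 * α - k) (2 * α)
      (b := 1 + 2 * α - k) (by ring) hz]
    ring
  have hSder : ∀ z, 0 < z → HasDerivAt (S 0) (S (0 - 1) z) z := fun z hz =>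
    hasDerivAt_gammaSeriesSum hα1 (fun k => gammaSummable_gammaCoeff _ _ hd)
      (fun k => gammaSummable_gammaCoeff _ _ hd) 0 hz
  have hRder : ∀ z, 0 < z → HasDerivAt (R 0) (R (0 - 1) z) z := fun z hz =>
    hasDerivAt_gammaSeriesSum hα1 (fun k => gammaSummable_gammaCoeff _ _ hd)
      (fun k => gammaSummable_gammaCoeff _ _ hd) 0 hz
  have hSR : ∀ z, 0 < z → S (-α) z = a * R 0 z - 1 / α * (z * R (0 - 1) z) := by
    intro z hz
    simp only [S, R, gammaSeriesSum, Finset.mul_sum, ← Finset.sum_sub_distrib]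
    refine Finset.sum_congr rfl fun k hk => ?_
    have hk1 := (Finset.mem_Icc.1 hk).1
    have e1 := gammaSeries_gammaCoeff_euler hα1 (p := A k) (E k) (c := 2 * α - k) (s := a)
      (fun j => hne (hpole k hk j).1) (by simp only [A]; field_simp; ring) hz
    have e2 := gammaSeries_gammaCoeff_euler hα1 (p := F k) (D k) (c := α - k) (s := a)
      (fun j => hne (hpole k hk j).2.2.2.2.2) (by simp only [F]; field_simp; ring) hz
    have e3 := gammaSeries_gammaCoeff_neg_natCast (p := A k) (q := B k) hd hk1 hz
    rw [← hEB] at e3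
    rw [← hCF] at e2
    rw [show α - (k : ℝ) + -α = -k by ring, show 2 * α - (k : ℝ) + -α = α - k by ring, e3,
      add_zero, add_zero, zero_sub, ← sub_eq_add_neg, ← sub_eq_add_neg]
    linear_combination (-c₂ k) * e2 + 2 * c₁ k * e1
  have hRS : ∀ z, 0 < z →
      R (-α) z = (a + lam₂) * S 0 z - 1 / α * (z * S (0 - 1) z) := by
    intro z hz
    simp only [S, R, gammaSeriesSum, Finset.mul_sum, ← Finset.sum_sub_distrib]
    refine Finset.sum_congr rfl fun k hk => ?_
    have hk1 := (Finset.mem_Icc.1 hk).1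
    have e1 := gammaSeries_gammaCoeff_euler hα1 (p := D k) (C k) (c := 2 * α - k)
      (s := a + lam₂) (fun j => hne (hpole k hk j).2.2.2.1)
      (by simp only [D]; field_simp; ring) hz
    have e2 := gammaSeries_gammaCoeff_euler hα1 (p := B k) (A k) (c := α - k) (s := a + lam₂)
      (fun j => hne (hpole k hk j).2.1) (by simp only [B]; field_simp; ring) hz
    have e3 := gammaSeries_gammaCoeff_neg_natCast (p := F k) (q := D k) hd hk1 hz
    rw [← hCF] at e3
    rw [← hEB, gammaCoeff_comm (B k), gammaCoeff_comm (E k)] at e2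
    rw [gammaCoeff_comm (D k), gammaCoeff_comm (D k + 1)] at e1
    rw [show α - (k : ℝ) + -α = -k by ring, show 2 * α - (k : ℝ) + -α = α - k by ring, e3,
      add_zero, add_zero, zero_sub, ← sub_eq_add_neg, ← sub_eq_add_neg]
    linear_combination (-c₁ k) * e2 + 2 * c₂ k * e1
  intro x hx t ht
  have ht0 : 0 < t := ht
  have hωx := hωpos x hx
  have hfx := hfpos x hx
  have hsf : 0 < √(f x) := Real.sqrt_pos.2 hfx
  have hsq : √(f x) * √(f x) = f x := Real.mul_self_sqrt hfx.le
  have hIx : I ∈ nhds x := hI.mem_nhds hx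
  have hfder : HasDerivAt f (deriv f x) x :=
    ((hfs.contDiffAt hIx).differentiableAt (by simp)).hasDerivAt
  have hcont : ContinuousOn (fun r => (√(f r))⁻¹) I :=
    (hfs.continuousOn.sqrt).inv₀ fun r hr => (Real.sqrt_pos.2 (hfpos r hr)).ne'
  have hωder : HasDerivAt ω (√(f x))⁻¹ x := by
    have h := intervalIntegral.integral_hasDerivAt_right
      ((hcont.mono (hIc.uIcc_subset hβ hx)).intervalIntegrable (μ := volume))
      (hcont.stronglyMeasurableAtFilter hI x hx) (hcont.continuousAt hIx)
    rw [funext hω]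
    exact h.add_const lam₁
  have hρ : 0 < ω x ^ (-(1 / α)) := Real.rpow_pos_of_pos hωx _
  have hρα : (ω x ^ (-(1 / α))) ^ α = (ω x)⁻¹ := by
    rw [← Real.rpow_mul hωx.le, neg_mul, one_div_mul_cancel hα0.ne', Real.rpow_neg_one]
  have hz : 0 < ω x ^ (-(1 / α)) * t := by positivity
  have hu' : ∀ y ∈ I, u y t = (√(f y))⁻¹ * (ω y ^ a * S 0 (ω y ^ (-(1 / α)) * t)) := by
    intro y hy
    have := Real.rpow_pos_of_pos (hωpos y hy) (-(1 / α))
    rw [hu, hφS _ (by positivity), mul_assoc]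
  have hv' : ∀ y ∈ I, v y t = ω y ^ a * R 0 (ω y ^ (-(1 / α)) * t) := by
    intro y hy
    have := Real.rpow_pos_of_pos (hωpos y hy) (-(1 / α))
    rw [hv, hψR _ (by positivity)]
  have hDu : rlDeriv n α (fun s => u x s) t = (√(f x))⁻¹ * ω x ^ a *
      ((ω x ^ (-(1 / α))) ^ α * S (-α) (ω x ^ (-(1 / α)) * t)) := by
    refine HasRLDeriv.rlDeriv_eq (h' := fun t => (√(f x))⁻¹ * ω x ^ a *
      ((ω x ^ (-(1 / α))) ^ α * S (-α) (ω x ^ (-(1 / α)) * t))) ?_ ht0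
    refine ((hasRLDeriv_gammaSeriesSum hα1 hαn hn (fun k => gammaSummable_gammaCoeff _ _ hd)
      (fun k => gammaSummable_gammaCoeff _ _ hd) hρ).const_mul _).congr (fun s hs => ?_)
      fun s hs => rfl
    rw [hu, hφS _ (by positivity)]
  have hDv : rlDeriv n α (fun s => v x s) t = ω x ^ a *
      ((ω x ^ (-(1 / α))) ^ α * R (-α) (ω x ^ (-(1 / α)) * t)) := by
    refine HasRLDeriv.rlDeriv_eq (h' := fun t => ω x ^ a *
      ((ω x ^ (-(1 / α))) ^ α * R (-α) (ω x ^ (-(1 / α)) * t))) ?_ ht0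
    refine ((hasRLDeriv_gammaSeriesSum hα1 hαn hn (fun k => gammaSummable_gammaCoeff _ _ hd)
      (fun k => gammaSummable_gammaCoeff _ _ hd) hρ).const_mul _).congr (fun s hs => ?_)
      fun s hs => rfl
    rw [hv, hψR _ (by positivity)]
  have hVder := hasDerivAt_rpow_mul_comp_rpow a α t hωx hωder (hRder _ hz)
  have hUder := (hfder.sqrt hfx.ne').inv hsf.ne' |>.mul
    (hasDerivAt_rpow_mul_comp_rpow a α t hωx hωder (hSder _ hz))
  have hvx : (fun y => v y t) =ᶠ[nhds x] fun y => ω y ^ a * R 0 (ω y ^ (-(1 / α)) * t) := by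
    filter_upwards [hIx] with y hy using hv' y hy
  have hux := (hUder.congr_of_eventuallyEq (f₁ := fun y => u y t)
    (by filter_upwards [hIx] with y hy using hu' y hy)).deriv
  refine ⟨?_, ?_⟩
  · rw [hDu, hvx.deriv_eq, hVder.deriv, hρα, hSR _ hz]
    ring
  · rw [hDv, hux, hρα, hRS _ hz, hu' x hx, hg x hx]
    simp only [Pi.inv_apply]
    generalize √(f x) = q at *
    rw [← hsq]
    field_simp
    ring
end
end
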